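/- arXiv:2506.21087 — 3 statements merged into one kernel-verified Lean document; each statement's English description precedes it below -/
import Mathlib

section
/- Assume that E is a compact Polish space and that for every integer k ≥ 1 the map (x,μ) ↦ K_{μ,∂}^k(x,E) is continuous on E × P(E) (P(E) carrying the topology of weak convergence). If for every (x,μ) ∈ E × P(E) there exists an integer ℓ ≥ 1 with K_{μ,∂}^ℓ(x,E) < 1, then there exists an integer ℓ ≥ 1 such that sup_{(x,μ)∈E×P(E)} K_{μ,∂}^ℓ(x,E) < 1. -/
open MeasureTheory Filter Topology
open scoped ENNReal NNReal

noncomputable section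

namespace QSD

variable {E : Type*}

/-- `n`-fold iterate of a sub-Markov kernel given as a measure-valued map:
`kIter K 0 x = δ_x` and `kIter K (n+1) x = (K x).bind (kIter K n)`. -/
def kIter [MeasurableSpace E] (K : E → Measure E) : ℕ → E → Measure E
  | 0, x => Measure.dirac x
  | n + 1, x => (K x).bind (kIter K n)

/-- Total variation distance between two measures: supremum over measurable sets
of the absolute difference of the masses. -/
def tvDist [MeasurableSpace E] (μ ν : Measure E) : ℝ :=
  ⨆ A : {s : Set E // MeasurableSet s}, |(μ (A : Set E)).toReal - (ν (A : Set E)).toReal|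

/-- The kernel `A_μ(x,·) = Σ_{n≥0} K_{μ,∂}^n(x,·)`. -/
def Aker [MeasurableSpace E] (K : E → Measure E) (x : E) : Measure E :=
  Measure.sum fun n => kIter K n x

/-- `Π_μ = μ A_μ / (μ A_μ)(E)`. -/
def Pim [MeasurableSpace E] (K : E → Measure E) (μ : Measure E) : Measure E :=
  ((μ.bind (Aker K)) Set.univ)⁻¹ • μ.bind (Aker K)

/-- The kernel with redistribution (rebirth) `𝕂_μ(x,·) = K_{μ,∂}(x,·) + δ_μ(x)·μ(·)`,
where `δ_μ(x) = 1 - K_{μ,∂}(x,E)`. -/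
def Kret [MeasurableSpace E] (K : E → Measure E) (μ : Measure E) (x : E) : Measure E :=
  K x + (1 - K x Set.univ) • μ

/-- Iterated application of a family of kernels to the constant function `𝟙`:
`chainV K [μ₁,…,μ_k] x = (K_{μ₁}(K_{μ₂}(⋯(K_{μ_k} 𝟙)⋯)))(x)`. -/
def chainV {V : Type*} [MeasurableSpace V] {I : Type*} (K : I → V → Measure V) :
    List I → V → ℝ≥0∞
  | [], _ => 1
  | μ :: L, x => ∫⁻ y, chainV K L y ∂(K μ x)

end QSD

open QSD

namespace QSD

lemma measurable_kIter {E : Type*} [MeasurableSpace E] {K : E → Measure E} (hK : Measurable K)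
    (n : ℕ) : Measurable (kIter K n) := by
  induction n with
  | zero => exact Measure.measurable_dirac
  | succ n ih => exact (Measure.measurable_bind' ih).comp hK

lemma kIter_succ_univ {E : Type*} [MeasurableSpace E] {K : E → Measure E} (hK : Measurable K)
    (n : ℕ) (x : E) : kIter K (n + 1) x Set.univ = ∫⁻ y, kIter K n y Set.univ ∂(K x) :=
  Measure.bind_apply MeasurableSet.univ (measurable_kIter hK n).aemeasurable

/-- Survival probabilities of a sub-Markov kernel decrease in time. -/
lemma antitone_kIter_univ {E : Type*} [MeasurableSpace E] {K : E → Measure E} (hK : Measurable K)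
    (hsub : ∀ x, K x Set.univ ≤ 1) (x : E) : Antitone fun n => kIter K n x Set.univ := by
  refine antitone_nat_of_succ_le fun n => ?_
  induction n generalizing x with
  | zero =>
    rw [kIter_succ_univ hK]
    simpa [kIter] using hsub x
  | succ n ih =>
    rw [kIter_succ_univ hK (n + 1), kIter_succ_univ hK n]
    exact lintegral_mono ih

/-- An antitone sequence of continuous functions on a compact space, whose members are eventually
below `c` at every point, is eventually uniformly below some constant less than `c`. -/
lemma exists_uniform_bound_of_antitone {X : Type*} [TopologicalSpace X] [CompactSpace X]
    {f : ℕ → X → ℝ≥0∞} {c : ℝ≥0∞} (hc : 0 < c) (hanti : ∀ p, Antitone fun n => f n p)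
    (hcont : ∀ n, 1 ≤ n → Continuous (f n)) (hlt : ∀ p, ∃ n, 1 ≤ n ∧ f n p < c) :
    ∃ n, 1 ≤ n ∧ ∃ ρ < c, ∀ p, f n p ≤ ρ := by
  have hcont' (n : ℕ) : Continuous (f (n + 1)) := hcont (n + 1) (Nat.le_add_left 1 n)
  have hcover : (Set.univ : Set X) ⊆ ⋃ n, {p | f (n + 1) p < c} := fun p _ => by
    obtain ⟨l, -, hl⟩ := hlt p
    exact Set.mem_iUnion.2 ⟨l, (hanti p l.le_succ).trans_lt hl⟩
  have hmono : Monotone fun n => {p | f (n + 1) p < c} := fun m n hmn p hp =>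
    (hanti p (Nat.succ_le_succ hmn)).trans_lt hp
  obtain ⟨n, hn⟩ := isCompact_univ.elim_directed_cover _
    (fun n => isOpen_lt (hcont' n) continuous_const) hcover hmono.directed_le
  refine ⟨n + 1, Nat.le_add_left 1 n, ?_⟩
  rcases isEmpty_or_nonempty X with h | h
  · exact ⟨0, hc, fun p => h.elim p⟩
  · obtain ⟨q, -, hq⟩ := isCompact_univ.exists_isMaxOn Set.univ_nonempty (hcont' n).continuousOn
    exact ⟨f (n + 1) q, hn (Set.mem_univ q), fun p => hq (Set.mem_univ p)⟩

end QSD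

/-- Lemma 2.2: on a compact Polish space, if the iterated survival
probabilities are jointly continuous and pointwise eventually `< 1`, then some iterate
has survival probability uniformly bounded away from `1`. -/
theorem stmt0
    {E : Type*} [TopologicalSpace E] [PolishSpace E] [CompactSpace E]
    [MeasurableSpace E] [BorelSpace E]
    (K : ProbabilityMeasure E → E → Measure E)
    (hKmeas : ∀ μ, Measurable (K μ))
    (hKsub : ∀ μ x, K μ x Set.univ ≤ 1)
    (hcont : ∀ k : ℕ, 1 ≤ k →
      Continuous fun p : E × ProbabilityMeasure E => kIter (K p.2) k p.1 Set.univ)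
    (hpt : ∀ (x : E) (μ : ProbabilityMeasure E),
      ∃ ℓ : ℕ, 1 ≤ ℓ ∧ kIter (K μ) ℓ x Set.univ < 1) :
    ∃ ℓ : ℕ, 1 ≤ ℓ ∧ ∃ ρ : ℝ≥0∞, ρ < 1 ∧
      ∀ (x : E) (μ : ProbabilityMeasure E), kIter (K μ) ℓ x Set.univ ≤ ρ := by
  obtain ⟨n, hn, ρ, hρ, h⟩ := exists_uniform_bound_of_antitone
    (f := fun n (p : E × ProbabilityMeasure E) => kIter (K p.2) n p.1 Set.univ) zero_lt_one
    (fun p => antitone_kIter_univ (hKmeas p.2) (hKsub p.2) p.1) hcont (fun p => hpt p.1 p.2)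
  exact ⟨n, hn, ρ, hρ, fun x μ => h (x, μ)⟩
end
end

section
/- Assume (H0). Then for every μ ∈ P(E): μA_μ(E) ≥ 1 (so Π_μ := μA_μ/(μA_μ(E)) is a well-defined Borel probability measure on E); Π_μ is invariant for the Markov kernel 𝕂_μ, i.e. Π_μ𝕂_μ = Π_μ; and Π_μ is the unique probability measure on E invariant for 𝕂_μ. -/
open MeasureTheory Filter Topology
open scoped ENNReal NNReal

noncomputable section

open QSD

namespace QSD

variable {E : Type*} [MeasurableSpace E] {κ : E → Measure E}

theorem measurable_apply_of_measurable (hκ : Measurable κ) {s : Set E} (hs : MeasurableSet s) :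
    Measurable fun x => κ x s :=
  (Measure.measurable_coe hs).comp hκ

theorem measurable_defect (hκ : Measurable κ) : Measurable fun x => 1 - κ x Set.univ :=
  measurable_const.sub (measurable_apply_of_measurable hκ .univ)

theorem measurable_kIter_s2 (hκ : Measurable κ) (n : ℕ) : Measurable (kIter κ n) := by
  induction n with
  | zero => exact Measure.measurable_dirac
  | succ n ih => exact (Measure.measurable_bind' ih).comp hκ

theorem measurable_Aker (hκ : Measurable κ) : Measurable (Aker κ) := by
  refine Measure.measurable_of_measurable_coe _ fun s hs => ?_
  simp only [Aker, Measure.sum_apply _ hs]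
  exact Measurable.tsum fun n => measurable_apply_of_measurable (measurable_kIter_s2 hκ n) hs

theorem measurable_Kret (hκ : Measurable κ) (μ : Measure E) : Measurable (Kret κ μ) := by
  refine Measure.measurable_of_measurable_coe _ fun s hs => ?_
  simp only [Kret, Measure.add_apply, Measure.smul_apply, smul_eq_mul]
  exact (measurable_apply_of_measurable hκ hs).add ((measurable_defect hκ).mul_const _)

theorem bind_kIter_zero (ν : Measure E) : ν.bind (kIter κ 0) = ν :=
  Measure.bind_dirac

theorem bind_kIter_succ (hκ : Measurable κ) (ν : Measure E) (n : ℕ) :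
    ν.bind (kIter κ (n + 1)) = (ν.bind κ).bind (kIter κ n) :=
  (Measure.bind_bind hκ.aemeasurable (measurable_kIter_s2 hκ n).aemeasurable).symm

theorem bind_kIter_add (hκ : Measurable κ) (ν : Measure E) (m n : ℕ) :
    ν.bind (kIter κ (m + n)) = (ν.bind (kIter κ m)).bind (kIter κ n) := by
  induction m generalizing ν with
  | zero => rw [bind_kIter_zero, zero_add]
  | succ m ih => rw [add_right_comm, bind_kIter_succ hκ, ih, bind_kIter_succ hκ]

theorem bind_bind_kIter (hκ : Measurable κ) (ν : Measure E) (n : ℕ) :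
    (ν.bind (kIter κ n)).bind κ = (ν.bind κ).bind (kIter κ n) := by
  rw [← bind_kIter_succ hκ, bind_kIter_add hκ, bind_kIter_succ hκ, bind_kIter_zero]

theorem bind_Aker (hκ : Measurable κ) (ν : Measure E) :
    ν.bind (Aker κ) = Measure.sum fun n => ν.bind (kIter κ n) := by
  ext s hs
  rw [Measure.bind_apply hs (measurable_Aker hκ).aemeasurable, Measure.sum_apply _ hs]
  simp only [Aker, Measure.sum_apply _ hs]
  rw [lintegral_tsum fun n =>
    (measurable_apply_of_measurable (measurable_kIter_s2 hκ n) hs).aemeasurable]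
  exact tsum_congr fun n => (Measure.bind_apply hs (measurable_kIter_s2 hκ n).aemeasurable).symm

theorem bind_Aker_eq_add (hκ : Measurable κ) (ν : Measure E) :
    ν.bind (Aker κ) = ν + (ν.bind κ).bind (Aker κ) := by
  ext s hs
  rw [bind_Aker hκ, bind_Aker hκ, Measure.add_apply, Measure.sum_apply _ hs,
    Measure.sum_apply _ hs, tsum_eq_zero_add' ENNReal.summable, bind_kIter_zero]
  simp only [bind_kIter_succ hκ]

theorem bind_Aker_bind (hκ : Measurable κ) (ν : Measure E) :
    (ν.bind (Aker κ)).bind κ = (ν.bind κ).bind (Aker κ) := by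
  rw [bind_Aker hκ, bind_Aker hκ, Measure.bind_sum _ _ hκ.aemeasurable]
  simp only [bind_bind_kIter hκ]

theorem bind_kIter_univ_le (hκ : Measurable κ) (hsub : ∀ x, κ x Set.univ ≤ 1)
    (ν : Measure E) (n : ℕ) : ν.bind (kIter κ n) Set.univ ≤ ν Set.univ := by
  induction n generalizing ν with
  | zero => rw [bind_kIter_zero]
  | succ n ih =>
    rw [bind_kIter_succ hκ]
    refine (ih _).trans ?_
    rw [Measure.bind_apply .univ hκ.aemeasurable]
    simpa using lintegral_mono (μ := ν) hsub

theorem isFiniteMeasure_bind_Aker (hκ : Measurable κ) (hsub : ∀ x, κ x Set.univ ≤ 1)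
    {ℓ : ℕ} (hℓ : 1 ≤ ℓ) {ρ : ℝ≥0∞} (hρ : ρ < 1) (h : ∀ x, kIter κ ℓ x Set.univ ≤ ρ)
    (ν : Measure E) [IsFiniteMeasure ν] : IsFiniteMeasure (ν.bind (Aker κ)) := by
  have : NeZero ℓ := ⟨by omega⟩
  have hdecay (q r : ℕ) :
      ν.bind (kIter κ (q * ℓ + r)) Set.univ ≤ ρ ^ q * ν Set.univ := by
    induction q with
    | zero => simpa using bind_kIter_univ_le hκ hsub ν r
    | succ q ih =>
      rw [show (q + 1) * ℓ + r = q * ℓ + r + ℓ by ring, bind_kIter_add hκ,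
        Measure.bind_apply .univ (measurable_kIter_s2 hκ ℓ).aemeasurable]
      calc _ ≤ ∫⁻ _, ρ ∂(ν.bind (kIter κ (q * ℓ + r))) := lintegral_mono h
        _ = ρ * ν.bind (kIter κ (q * ℓ + r)) Set.univ := lintegral_const _
        _ ≤ ρ * (ρ ^ q * ν Set.univ) := by gcongr
        _ = _ := by ring
  refine ⟨?_⟩
  rw [bind_Aker hκ, Measure.sum_apply _ .univ, ← (Nat.divModEquiv ℓ).symm.tsum_eq,
    ENNReal.tsum_prod']
  calc _ ≤ ∑' q : ℕ, ∑' _ : Fin ℓ, ρ ^ q * ν Set.univ :=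
        ENNReal.tsum_le_tsum fun q => ENNReal.tsum_le_tsum fun r => hdecay q r
    _ = ℓ * ((1 - ρ)⁻¹ * ν Set.univ) := by
        simp [ENNReal.tsum_mul_left, ENNReal.tsum_mul_right, ENNReal.tsum_geometric]
    _ < ∞ := ENNReal.mul_lt_top (ENNReal.natCast_lt_top ℓ) (ENNReal.mul_lt_top
        (ENNReal.inv_lt_top.2 (tsub_pos_of_lt hρ)) (measure_lt_top ν _))

theorem bind_add_left {f : E → Measure E} (hf : Measurable f) (ν₁ ν₂ : Measure E) :
    (ν₁ + ν₂).bind f = ν₁.bind f + ν₂.bind f := by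
  ext s hs
  simp only [Measure.add_apply, Measure.bind_apply hs hf.aemeasurable, lintegral_add_measure]

theorem bind_Kret (hκ : Measurable κ) (μ ν : Measure E) :
    ν.bind (Kret κ μ) = ν.bind κ + (∫⁻ x, (1 - κ x Set.univ) ∂ν) • μ := by
  ext s hs
  rw [Measure.bind_apply hs (measurable_Kret hκ μ).aemeasurable, Measure.add_apply,
    Measure.bind_apply hs hκ.aemeasurable, Measure.smul_apply, smul_eq_mul]
  simp only [Kret, Measure.add_apply, Measure.smul_apply, smul_eq_mul]
  rw [lintegral_add_left (measurable_apply_of_measurable hκ hs),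
    lintegral_mul_const _ (measurable_defect hκ)]

theorem bind_univ_add_lintegral (hκ : Measurable κ) (hsub : ∀ x, κ x Set.univ ≤ 1)
    (ν : Measure E) :
    ν.bind κ Set.univ + ∫⁻ x, (1 - κ x Set.univ) ∂ν = ν Set.univ := by
  rw [Measure.bind_apply .univ hκ.aemeasurable,
    ← lintegral_add_left (measurable_apply_of_measurable hκ .univ)]
  simp [add_tsub_cancel_of_le (hsub _)]

theorem bind_Aker_bind_Kret (hκ : Measurable κ) (hsub : ∀ x, κ x Set.univ ≤ 1)
    (μ : Measure E) [IsProbabilityMeasure μ] [IsFiniteMeasure (μ.bind (Aker κ))] :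
    (μ.bind (Aker κ)).bind (Kret κ μ) = μ.bind (Aker κ) := by
  have hN : μ.bind (Aker κ) = μ + (μ.bind (Aker κ)).bind κ := by
    rw [bind_Aker_bind hκ, ← bind_Aker_eq_add hκ]
  have hmass := bind_univ_add_lintegral hκ hsub (μ.bind (Aker κ))
  have huniv : μ.bind (Aker κ) Set.univ = 1 + (μ.bind (Aker κ)).bind κ Set.univ := by
    conv_lhs => rw [hN]
    rw [Measure.add_apply, measure_univ]
  have hfin : (μ.bind (Aker κ)).bind κ Set.univ ≠ ∞ :=
    ne_top_of_le_ne_top (measure_ne_top _ _) (le_add_self.trans_eq huniv.symm)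
  rw [huniv, add_comm 1] at hmass
  rw [bind_Kret hκ, (ENNReal.add_right_inj hfin).1 hmass, one_smul, add_comm, ← hN]

theorem eq_smul_bind_Aker_of_bind_Kret_eq (hκ : Measurable κ) (μ π : Measure E)
    [IsFiniteMeasure (π.bind (Aker κ))] (hπ : π.bind (Kret κ μ) = π) :
    π = (∫⁻ x, (1 - κ x Set.univ) ∂π) • μ.bind (Aker κ) := by
  have hsum := bind_Aker_eq_add hκ π
  have hinv : π.bind (Aker κ) = (∫⁻ x, (1 - κ x Set.univ) ∂π) • μ.bind (Aker κ)
      + (π.bind κ).bind (Aker κ) := by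
    conv_lhs => rw [← hπ, bind_Kret hκ, bind_add_left (measurable_Aker hκ),
      Measure.bind_smul, add_comm]
  ext s hs
  have hfin : (π.bind κ).bind (Aker κ) s ≠ ∞ := by
    refine ne_top_of_le_ne_top (measure_ne_top (π.bind (Aker κ)) s) ?_
    rw [hsum, Measure.add_apply]
    exact le_add_self
  refine (ENNReal.add_left_inj hfin).1 ?_
  rw [← Measure.add_apply, ← Measure.add_apply, ← hsum, ← hinv]

end QSD

/-- Lemma 3.1 (ii): under (H0), for every `μ ∈ P(E)` the measure `μA_μ`
has total mass `≥ 1`, the normalization `Π_μ = μA_μ/(μA_μ(E))` is a probability measure,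
it is invariant for the Markov kernel `𝕂_μ`, and it is the unique invariant probability. -/
theorem stmt2
    {E : Type*} [MeasurableSpace E]
    (K : ProbabilityMeasure E → E → Measure E)
    (hKmeas : ∀ μ, Measurable (K μ))
    (hKsub : ∀ μ x, K μ x Set.univ ≤ 1)
    (ℓ : ℕ) (hℓ : 1 ≤ ℓ) (ρ : ℝ≥0∞) (hρ : ρ < 1)
    (hH0 : ∀ (μ : ProbabilityMeasure E) (x : E), kIter (K μ) ℓ x Set.univ ≤ ρ) :
    ∀ μ : ProbabilityMeasure E,
      1 ≤ ((μ : Measure E).bind (Aker (K μ))) Set.univ ∧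
      IsProbabilityMeasure (Pim (K μ) (μ : Measure E)) ∧
      (Pim (K μ) (μ : Measure E)).bind (Kret (K μ) (μ : Measure E))
        = Pim (K μ) (μ : Measure E) ∧
      ∀ π : Measure E, IsProbabilityMeasure π →
        π.bind (Kret (K μ) (μ : Measure E)) = π → π = Pim (K μ) (μ : Measure E) := by
  intro μ
  have hκ := hKmeas μ
  have hfinite (ν : Measure E) [IsFiniteMeasure ν] : IsFiniteMeasure (ν.bind (Aker (K μ))) :=
    isFiniteMeasure_bind_Aker hκ (hKsub μ) hℓ hρ (hH0 μ) ν
  have hN := hfinite μ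
  have hone : 1 ≤ ((μ : Measure E).bind (Aker (K μ))) Set.univ := by
    rw [bind_Aker_eq_add hκ, Measure.add_apply, measure_univ]
    exact le_self_add
  refine ⟨hone, ⟨?_⟩, ?_, fun π _ hπ => ?_⟩
  · rw [Pim, Measure.smul_apply, smul_eq_mul]
    exact ENNReal.inv_mul_cancel (zero_lt_one.trans_le hone).ne' (measure_ne_top _ _)
  · rw [Pim, Measure.bind_smul, bind_Aker_bind_Kret hκ (hKsub μ)]
  · have := hfinite π
    have heq := eq_smul_bind_Aker_of_bind_Kret_eq hκ μ π hπ
    have hmass := congrArg (fun ν : Measure E => ν Set.univ) heq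
    simp only [measure_univ, Measure.smul_apply, smul_eq_mul] at hmass
    rw [Pim, ← ENNReal.eq_inv_of_mul_eq_one_left hmass.symm]
    exact heq
end
end

section
/- Suppose there exist Ψ ∈ P(E) and constants 0 < c₁ ≤ c₂ < ∞ such that c₁Ψ(A) ≤ K_{μ,∂}(x,A) ≤ c₂Ψ(A) for every (x,μ) ∈ E × P(E) and every Borel set A ⊆ E. Then for every k ≥ 1 and all μ₁, …, μ_k ∈ P(E), the function g := K_{μ₁,∂}(K_{μ₂,∂}(⋯(K_{μ_k,∂}𝟙)⋯)) satisfies Ψ(g) ≥ (c₁/c₂)·g(x) for every x ∈ E; that is, assumption (H4) holds with c = c₁/c₂. -/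
open MeasureTheory Filter Topology
open scoped ENNReal NNReal

noncomputable section

open QSD

/-- Lemma 2.5: if `c₁Ψ ≤ K_{μ,∂}(x,·) ≤ c₂Ψ` uniformly in `(x,μ)`, then
assumption (H4) holds with `c = c₁/c₂`: for every nonempty finite word `μ₁,…,μ_k`, the
function `g = K_{μ₁,∂}∘⋯∘K_{μ_k,∂} 𝟙` satisfies `Ψ(g) ≥ (c₁/c₂)·g(x)` for all `x`. -/
theorem stmt10
    {E : Type*} [MeasurableSpace E]
    (K : ProbabilityMeasure E → E → Measure E)
    (hKmeas : ∀ μ, Measurable (K μ))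
    (hKsub : ∀ μ x, K μ x Set.univ ≤ 1)
    (Ψ : Measure E) (hΨ : IsProbabilityMeasure Ψ)
    (c₁ c₂ : ℝ≥0∞) (hc₁ : 0 < c₁) (hc₁₂ : c₁ ≤ c₂) (hc₂ : c₂ < ⊤)
    (hbound : ∀ (μ : ProbabilityMeasure E) (x : E) (A : Set E), MeasurableSet A →
      c₁ * Ψ A ≤ K μ x A ∧ K μ x A ≤ c₂ * Ψ A) :
    ∀ L : List (ProbabilityMeasure E), L ≠ [] → ∀ x : E,
      c₁ / c₂ * chainV K L x ≤ ∫⁻ y, chainV K L y ∂Ψ := by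
  intro L hL x
  obtain ⟨μ, L, rfl⟩ := List.exists_cons_of_ne_nil hL
  have hupper : K μ x ≤ c₂ • Ψ :=
    Measure.le_iff.2 fun A hA => by simpa using (hbound μ x A hA).2
  have hlower (y : E) : c₁ • Ψ ≤ K μ y :=
    Measure.le_iff.2 fun A hA => by simpa using (hbound μ y A hA).1
  have hc₂_ne_zero : c₂ ≠ 0 := (hc₁.trans_le hc₁₂).ne'
  simp only [chainV]
  calc
    c₁ / c₂ * ∫⁻ y, chainV K L y ∂(K μ x)
        ≤ c₁ / c₂ * (c₂ * ∫⁻ y, chainV K L y ∂Ψ) := by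
      gcongr
      simpa [lintegral_smul_measure] using lintegral_mono' hupper (le_refl (chainV K L))
    _ = c₁ * ∫⁻ y, chainV K L y ∂Ψ := by
      rw [← mul_assoc, ENNReal.div_mul_cancel hc₂_ne_zero hc₂.ne]
    _ = ∫⁻ _, c₁ * ∫⁻ y, chainV K L y ∂Ψ ∂Ψ := by simp
    _ ≤ ∫⁻ z, ∫⁻ y, chainV K L y ∂(K μ z) ∂Ψ := by
      refine lintegral_mono fun z => ?_
      simpa [lintegral_smul_measure] using lintegral_mono' (hlower z) (le_refl (chainV K L))
end
end
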